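/- Let L be a positive natural number and let (n_l)_{l=0}^{L} be positive natural numbers with N = n_L. Let C ∈ ℝ^{N×N}, and for each l ∈ {1, …, L} let U_l ∈ ℝ^{n_l × n_{l-1}}, V_l ∈ ℝ^{n_{l-1} × n_l}, and M_l ∈ ℝ^{n_{l-1} × n_{l-1}} be matrices, and let q ∈ ℝ^N. Define the downward pass by q̂_L = V_L q and q̂_{l} = V_{l} q̂_{l+1} for l = L−1, …, 1, and the upward pass by t_1 = M_1 q̂_1 and t_l = M_l q̂_l + U_{l-1} t_{l-1} for l = 2, …, L. Then the vector w = C q + U_L t_L equals w = C q + Σ_{l=1}^{L} (U_L * U_{L-1} * ⋯ * U_l) * M_l * (V_l * ⋯ * V_L) * q. -/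

import Mathlib

/-- Correctness of the H² matrix-by-vector multiplication algorithm:
the downward pass `q̂ L = V L q`, `q̂ l = V l q̂ (l+1)` and the upward pass
`t 1 = M 1 q̂ 1`, `t l = M l q̂ l + U (l-1) t (l-1)` compute exactly
`w = C q + U L t L = C q + ∑_{l=1}^{L} (U_L ⋯ U_l) M_l (V_l ⋯ V_L) q`,
where `P l = U L * ⋯ * U l` and `Q l = V l * ⋯ * V L` are the partial products. -/
theorem h2_matvec_algorithm_correct
    (L : ℕ) (hL : 0 < L)
    (n : ℕ → ℕ) (hn : ∀ l ≤ L, 0 < n l)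
    (C : Matrix (Fin (n L)) (Fin (n L)) ℝ)
    (U : (l : ℕ) → Matrix (Fin (n l)) (Fin (n (l - 1))) ℝ)
    (V : (l : ℕ) → Matrix (Fin (n (l - 1))) (Fin (n l)) ℝ)
    (M : (l : ℕ) → Matrix (Fin (n (l - 1))) (Fin (n (l - 1))) ℝ)
    (q : Fin (n L) → ℝ)
    (qh : (l : ℕ) → Fin (n (l - 1)) → ℝ)
    (hqL : qh L = (V L).mulVec q)
    (hqs : ∀ l, 2 ≤ l → l ≤ L → qh (l - 1) = (V (l - 1)).mulVec (qh l))
    (t : (l : ℕ) → Fin (n (l - 1)) → ℝ)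
    (ht1 : t 1 = (M 1).mulVec (qh 1))
    (hts : ∀ l, 2 ≤ l → l ≤ L →
      t l = (M l).mulVec (qh l) + (U (l - 1)).mulVec (t (l - 1)))
    (P : (l : ℕ) → Matrix (Fin (n L)) (Fin (n (l - 1))) ℝ)
    (hPL : P L = U L)
    (hPs : ∀ l, 2 ≤ l → l ≤ L → P (l - 1) = P l * U (l - 1))
    (Q : (l : ℕ) → Matrix (Fin (n (l - 1))) (Fin (n L)) ℝ)
    (hQL : Q L = V L)
    (hQs : ∀ l, 2 ≤ l → l ≤ L → Q (l - 1) = V (l - 1) * Q l) :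
    C.mulVec q + (U L).mulVec (t L) =
      C.mulVec q + ∑ l ∈ Finset.Icc 1 L, (P l * M l * Q l).mulVec q := by
  have hqh : ∀ l, 1 ≤ l → l ≤ L → qh l = (Q l).mulVec q := by
    intro l hl hlL
    induction hlL using Nat.decreasingInduction with
    | self => rw [hqL, hQL]
    | of_succ k hk ih =>
      change qh (k + 1 - 1) = (Q (k + 1 - 1)).mulVec q
      rw [hqs (k + 1) (by omega) hk, hQs (k + 1) (by omega) hk, ih (by omega),
        Matrix.mulVec_mulVec]
  have ht : ∀ l, 1 ≤ l → l ≤ L →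
      (P l).mulVec (t l) = ∑ k ∈ Finset.Icc 1 l, (P k * M k * Q k).mulVec q := by
    intro l hl
    induction l, hl using Nat.le_induction with
    | base =>
      intro h
      rw [Finset.Icc_self, Finset.sum_singleton, ht1, hqh 1 le_rfl h,
        Matrix.mulVec_mulVec, Matrix.mulVec_mulVec, Matrix.mul_assoc]
    | succ k hk ih =>
      intro h
      rw [Finset.sum_Icc_succ_top (by omega), ← ih (by omega)]
      change _ = (P (k + 1 - 1)).mulVec (t (k + 1 - 1)) + _
      rw [hPs (k + 1) (by omega) h, hts (k + 1) (by omega) h,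
        hqh (k + 1) (by omega) h, Matrix.mulVec_add, add_comm]
      simp only [← Matrix.mulVec_mulVec]
  rw [← ht L hL le_rfl, hPL]
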